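/- Let q = 1. Suppose there exist constants ℓ > 0 and c₁, c₂, t₀ > 0 such that c₁ t^ℓ ≤ P(|G| ≤ t) ≤ c₂ t^ℓ for all t ∈ (0, t₀], and E[G²] < ∞, and assume δ > M_1(ε). Then for every natural number m ≥ 1 there exist constants α_m, β_m > 0 such that for all sufficiently small σ_w > 0: −β_m · σ_w^{ℓ+2} · (log log ⋯ log (1/σ_w))^{ℓ/2} (with m iterated logarithms) ≤ AMSE(σ_w) − [δ·M_1(ε)/(δ − M_1(ε))]·σ_w² ≤ −α_m · σ_w^{ℓ+2}. -/

import Mathlib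

open MeasureTheory ProbabilityTheory Real Filter Set

noncomputable section

/-- The standard Gaussian measure on `ℝ`. -/
def stdGaussian : Measure ℝ := gaussianReal 0 1

/-- Soft thresholding, i.e. `η₁(u;χ) = sign(u)·max(|u|−χ,0)`. -/
def soft (u χ : ℝ) : ℝ := Real.sign u * max (|u| - χ) 0

/-- `M₁(ε) = inf_{χ ≥ 0} [(1−ε)·E[η₁(Z;χ)²] + ε(1+χ²)]`, `Z ~ N(0,1)`. -/
def M1 (ε : ℝ) : ℝ :=
  ⨅ χ : NNReal, ((1 - ε) * ∫ z, (soft z (χ:ℝ))^2 ∂stdGaussian + ε * (1 + (χ:ℝ)^2))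

/-- The law of `B`: the mixture `(1−ε)δ₀ + ε·g`. -/
def mix (ε : ℝ) (g : Measure ℝ) : Measure ℝ :=
  ENNReal.ofReal (1 - ε) • Measure.dirac (0:ℝ) + ENNReal.ofReal ε • g

/-- `min_{χ ≥ 0} E[(η(B+σZ;χ) − B)²]` where `B ~ μB`, `Z ~ N(0,1)` independent. -/
def riskMin (η : ℝ → ℝ → ℝ) (μB : Measure ℝ) (σ : ℝ) : ℝ :=
  ⨅ χ : NNReal, ∫ b, (∫ z, (η (b + σ * z) (χ:ℝ) - b)^2 ∂stdGaussian) ∂μB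

/-- `iterLog m x`: the logarithm iterated `m` times, applied to `x`. -/
def iterLog : ℕ → ℝ → ℝ
  | 0, x => x
  | n+1, x => Real.log (iterLog n x)

instance : IsProbabilityMeasure _root_.stdGaussian := by
  unfold _root_.stdGaussian; infer_instance

lemma soft_eq_max_sub_max (u : ℝ) {χ : ℝ} (hχ : 0 ≤ χ) :
    soft u χ = max (u - χ) 0 - max (-u - χ) 0 := by
  unfold soft
  rcases lt_trichotomy u 0 with h | h | h
  · rw [Real.sign_of_neg h, abs_of_neg h, max_eq_right (by linarith : u - χ ≤ 0)]; ring
  · subst h; simp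
  · rw [Real.sign_of_pos h, abs_of_pos h, max_eq_right (by linarith : -u - χ ≤ 0)]; ring

lemma soft_of_lt {u χ : ℝ} (hχ : 0 ≤ χ) (h : χ < u) : soft u χ = u - χ := by
  rw [soft_eq_max_sub_max u hχ, max_eq_left (by linarith), max_eq_right (by linarith)]; ring

lemma soft_of_abs_le {u χ : ℝ} (h : |u| ≤ χ) : soft u χ = 0 := by
  unfold soft; rw [max_eq_right (by linarith), mul_zero]

lemma soft_of_lt_neg {u χ : ℝ} (hχ : 0 ≤ χ) (h : u < -χ) : soft u χ = u + χ := by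
  rw [soft_eq_max_sub_max u hχ, max_eq_right (by linarith), max_eq_left (by linarith)]; ring

lemma soft_neg (u : ℝ) {χ : ℝ} (hχ : 0 ≤ χ) : soft (-u) χ = -soft u χ := by
  rw [soft_eq_max_sub_max _ hχ, soft_eq_max_sub_max _ hχ, neg_neg]; ring

lemma soft_mul_left {σ : ℝ} (hσ : 0 < σ) (u : ℝ) {χ : ℝ} (hχ : 0 ≤ χ) :
    soft (σ * u) (σ * χ) = σ * soft u χ := by
  rw [soft_eq_max_sub_max _ hχ, soft_eq_max_sub_max _ (by positivity), mul_sub,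
    mul_max_of_nonneg _ _ hσ.le, mul_max_of_nonneg _ _ hσ.le]
  ring_nf

/-- The risk of soft thresholding at level `τ` for a unit-variance Gaussian observation of `μ`. -/
def softRisk (μ τ : ℝ) : ℝ := ∫ z, (soft (μ + z) τ - μ) ^ 2 ∂stdGaussian

lemma integrable_sq_stdGaussian : Integrable (fun z : ℝ => z ^ 2) stdGaussian :=
  (memLp_id_gaussianReal (μ := 0) (v := 1) 2).integrable_sq

lemma integrable_id_stdGaussian : Integrable (fun z : ℝ => z) stdGaussian :=
  (memLp_id_gaussianReal (μ := 0) (v := 1) 1).integrable le_rfl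

lemma integral_sq_stdGaussian : ∫ z, z ^ 2 ∂stdGaussian = 1 := by
  have h := variance_id_gaussianReal (μ := 0) (v := 1)
  rw [variance_of_integral_eq_zero aemeasurable_id (by simp)] at h
  simpa [_root_.stdGaussian] using h

lemma integrable_sub_sq_stdGaussian (τ : ℝ) :
    Integrable (fun z : ℝ => (z - τ) ^ 2) stdGaussian := by
  have h := (integrable_sq_stdGaussian.sub (integrable_id_stdGaussian.const_mul (2 * τ))).add
    (integrable_const (τ ^ 2))
  refine h.congr (ae_of_all _ fun z => ?_)
  simp only [Pi.add_apply, Pi.sub_apply]; ring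

lemma integral_sub_sq_stdGaussian (τ : ℝ) : ∫ z, (z - τ) ^ 2 ∂stdGaussian = 1 + τ ^ 2 := by
  have h : ∀ z : ℝ, (z - τ) ^ 2 = z ^ 2 - 2 * τ * z + τ ^ 2 := fun z => by ring
  simp_rw [h]
  rw [integral_add (f := fun z => z ^ 2 - 2 * τ * z)
      (integrable_sq_stdGaussian.sub (integrable_id_stdGaussian.const_mul _)) (integrable_const _),
    integral_sub integrable_sq_stdGaussian (integrable_id_stdGaussian.const_mul _),
    integral_sq_stdGaussian, integral_const_mul]
  simp [_root_.stdGaussian, integral_id_gaussianReal]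

lemma measureReal_stdGaussian_Ioo_pos {a b : ℝ} (h : a < b) :
    0 < stdGaussian.real (Ioo a b) := by
  refine ENNReal.toReal_pos (fun h0 => ?_) (measure_ne_top _ _)
  have := gaussianReal_absolutelyContinuous' 0 (one_ne_zero : (1 : NNReal) ≠ 0) h0
  simp at this
  linarith

lemma continuous_soft_add_sub {τ : ℝ} (hτ : 0 ≤ τ) :
    Continuous (fun p : ℝ × ℝ => (soft (p.1 + p.2) τ - p.1) ^ 2) := by
  simp_rw [soft_eq_max_sub_max _ hτ]
  fun_prop

lemma continuous_sq_soft_sub (μ : ℝ) {τ : ℝ} (hτ : 0 ≤ τ) :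
    Continuous (fun z => (soft (μ + z) τ - μ) ^ 2) :=
  (continuous_soft_add_sub hτ).comp (Continuous.prodMk_right μ)

lemma sq_soft_sub_le {μ τ : ℝ} (hμ : 0 ≤ μ) (hτ : 0 ≤ τ) (z : ℝ) :
    (soft (μ + z) τ - μ) ^ 2 ≤ (z - τ) ^ 2 := by
  rcases lt_or_ge τ (μ + z) with h | h
  · rw [soft_of_lt hτ h]; apply le_of_eq; ring
  rcases lt_or_ge (μ + z) (-τ) with h' | h'
  · rw [soft_of_lt_neg hτ h']; nlinarith
  · rw [soft_of_abs_le (abs_le.2 ⟨h', h⟩)]; nlinarith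

lemma integrable_sq_soft_sub {μ τ : ℝ} (hμ : 0 ≤ μ) (hτ : 0 ≤ τ) :
    Integrable (fun z => (soft (μ + z) τ - μ) ^ 2) stdGaussian := by
  refine (integrable_sub_sq_stdGaussian τ).mono'
    (continuous_sq_soft_sub μ hτ).aestronglyMeasurable (ae_of_all _ fun z => ?_)
  rw [Real.norm_of_nonneg (sq_nonneg _)]
  exact sq_soft_sub_le hμ hτ z

lemma softRisk_neg (μ : ℝ) {τ : ℝ} (hτ : 0 ≤ τ) : softRisk (-μ) τ = softRisk μ τ := by
  have hm : Measure.map (fun z => -z) _root_.stdGaussian = _root_.stdGaussian := by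
    simp [_root_.stdGaussian, gaussianReal_map_neg]
  unfold softRisk
  conv_lhs => rw [← hm]
  rw [integral_map (by fun_prop) (continuous_sq_soft_sub (-μ) hτ).aestronglyMeasurable]
  congr 1; ext z
  rw [← neg_add, soft_neg _ hτ]; ring

lemma softRisk_abs (μ : ℝ) {τ : ℝ} (hτ : 0 ≤ τ) : softRisk |μ| τ = softRisk μ τ := by
  rcases abs_choice μ with h | h <;> rw [h]
  exact softRisk_neg μ hτ

lemma softRisk_nonneg (μ τ : ℝ) : 0 ≤ softRisk μ τ := integral_nonneg fun _ => sq_nonneg _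

lemma softRisk_le (μ : ℝ) {τ : ℝ} (hτ : 0 ≤ τ) : softRisk μ τ ≤ 1 + τ ^ 2 := by
  rw [← softRisk_abs μ hτ, ← integral_sub_sq_stdGaussian τ]
  exact integral_mono (integrable_sq_soft_sub (abs_nonneg μ) hτ) (integrable_sub_sq_stdGaussian τ)
    (sq_soft_sub_le (abs_nonneg μ) hτ)

lemma exists_softRisk_ge_sub_exp (T : ℝ) : ∃ C, 0 < C ∧ ∀ μ τ, 0 ≤ τ → τ ≤ T →
    1 + τ ^ 2 - C * exp (-|μ|) ≤ softRisk μ τ := by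
  have hI : Integrable (fun z : ℝ => exp (-2 * z)) stdGaussian :=
    integrable_exp_mul_gaussianReal (-2)
  set A := ∫ z : ℝ, exp (-2 * z) ∂stdGaussian with hA
  have hA0 : 0 ≤ A := integral_nonneg fun z => (exp_pos _).le
  refine ⟨2 * exp (2 * T) * (A + 1), by positivity, fun μ τ hτ hT => ?_⟩
  rw [← softRisk_abs μ hτ]
  have hμ := abs_nonneg μ
  set ν := |μ|
  have key : ∀ z : ℝ, (z - τ) ^ 2 ≤
      (soft (ν + z) τ - ν) ^ 2 + 2 * exp (2 * T) * exp (-ν) * exp (-2 * z) := by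
    intro z
    rcases lt_or_ge τ (ν + z) with h | h
    · rw [soft_of_lt hτ h]
      have : 0 < 2 * exp (2 * T) * exp (-ν) * exp (-2 * z) := by positivity
      nlinarith
    · have h1 : (z - τ) ^ 2 ≤ 2 * exp (τ - z) := by
        have := Real.quadratic_le_exp_of_nonneg (show 0 ≤ τ - z by linarith)
        nlinarith
      have h2 : exp (τ - z) ≤ exp (2 * T) * exp (-ν) * exp (-2 * z) := by
        rw [← exp_add, ← exp_add, exp_le_exp]; linarith
      nlinarith [sq_nonneg (soft (ν + z) τ - ν)]
  have h := integral_mono (integrable_sub_sq_stdGaussian τ)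
    ((integrable_sq_soft_sub hμ hτ).add (hI.const_mul (2 * exp (2 * T) * exp (-ν)))) key
  simp only [Pi.add_apply] at h
  rw [integral_sub_sq_stdGaussian, integral_add (integrable_sq_soft_sub hμ hτ)
    (hI.const_mul _), integral_const_mul, ← hA] at h
  change 1 + τ ^ 2 ≤ softRisk ν τ + _ at h
  have : 0 < 2 * exp (2 * T) * exp (-ν) := by positivity
  nlinarith

lemma exists_softRisk_le_sub {τ₀ : ℝ} (hτ₀ : 0 < τ₀) (T : ℝ) : ∃ c, 0 < c ∧ ∀ μ τ, |μ| ≤ 1 →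
    τ₀ ≤ τ → τ ≤ T → softRisk μ τ ≤ 1 + τ ^ 2 - c := by
  have hp := measureReal_stdGaussian_Ioo_pos (show -T - 3 < -T - 2 by linarith)
  set S := Ioo (-T - 3) (-T - 2)
  refine ⟨8 * τ₀ * stdGaussian.real S, by positivity, fun μ τ hμ1 hτ hT => ?_⟩
  have hτ0 : 0 ≤ τ := by linarith
  rw [← softRisk_abs μ hτ0]
  have hμ := abs_nonneg μ
  set ν := |μ|
  have hS : MeasurableSet S := measurableSet_Ioo
  have hI : Integrable (S.indicator fun _ => 8 * τ₀) stdGaussian :=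
    (integrable_const _).indicator hS
  have key : ∀ z : ℝ, (soft (ν + z) τ - ν) ^ 2 + S.indicator (fun _ => 8 * τ₀) z ≤
      (z - τ) ^ 2 := by
    intro z
    by_cases hz : z ∈ S
    · rw [indicator_of_mem hz, soft_of_lt_neg hτ0 (by linarith [hz.2])]
      nlinarith [hz.2]
    · rw [indicator_of_notMem hz, add_zero]
      exact sq_soft_sub_le hμ hτ0 z
  have h := integral_mono ((integrable_sq_soft_sub hμ hτ0).add hI)
    (integrable_sub_sq_stdGaussian τ) key
  simp only [Pi.add_apply] at h
  rw [integral_sub_sq_stdGaussian, integral_add (integrable_sq_soft_sub hμ hτ0) hI,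
    integral_indicator_const _ hS, smul_eq_mul] at h
  change softRisk ν τ + _ ≤ _ at h
  linarith

lemma exists_softRisk_ge_min_sq : ∃ p, 0 < p ∧ ∀ μ τ, 0 ≤ τ →
    p * (min |μ| τ) ^ 2 ≤ softRisk μ τ := by
  refine ⟨_, measureReal_stdGaussian_Ioo_pos (show (-1 : ℝ) < 0 by norm_num), fun μ τ hτ => ?_⟩
  rw [← softRisk_abs μ hτ]
  have hμ := abs_nonneg μ
  set ν := |μ|
  have key : ∀ z : ℝ, (Ioo (-1 : ℝ) 0).indicator (fun _ => (min ν τ) ^ 2) z ≤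
      (soft (ν + z) τ - ν) ^ 2 := by
    intro z
    by_cases hz : z ∈ Ioo (-1 : ℝ) 0
    swap
    · rw [indicator_of_notMem hz]; exact sq_nonneg _
    rw [indicator_of_mem hz]
    have hz0 : z < 0 := hz.2
    have hm : 0 ≤ min ν τ := le_min hμ hτ
    have : min ν τ ≤ -(soft (ν + z) τ - ν) := by
      rcases lt_or_ge τ (ν + z) with h | h
      · rw [soft_of_lt hτ h]; linarith [min_le_right ν τ]
      rcases lt_or_ge (ν + z) (-τ) with h' | h'
      · rw [soft_of_lt_neg hτ h']; linarith [min_le_left ν τ]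
      · rw [soft_of_abs_le (abs_le.2 ⟨h', h⟩)]; linarith [min_le_left ν τ]
    nlinarith
  have h := integral_mono ((integrable_const _).indicator measurableSet_Ioo)
    (integrable_sq_soft_sub hμ hτ) key
  rwa [integral_indicator_const _ measurableSet_Ioo, smul_eq_mul] at h

lemma softRisk_zero_ge {τ : ℝ} (hτ : 0 ≤ τ) : 1 - 2 * τ ≤ softRisk 0 τ := by
  have hI := (integrable_sq_stdGaussian.const_mul (1 - τ)).sub (integrable_const τ)
  have h := integral_mono hI (integrable_sq_soft_sub le_rfl hτ) (fun z => by
    simp only [Pi.sub_apply, zero_add, sub_zero]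
    rcases lt_or_ge τ z with h | h
    · rw [soft_of_lt hτ h]; nlinarith [mul_nonneg hτ (sq_nonneg (z - 1))]
    rcases lt_or_ge z (-τ) with h' | h'
    · rw [soft_of_lt_neg hτ h']; nlinarith [mul_nonneg hτ (sq_nonneg (z + 1))]
    · rw [soft_of_abs_le (abs_le.2 ⟨h', h⟩)]
      rcases le_total 0 z with h0 | h0
      · nlinarith [mul_nonneg hτ (sq_nonneg (z - 1)), mul_nonneg h0 hτ]
      · nlinarith [mul_nonneg hτ (sq_nonneg (z + 1)), mul_nonneg (neg_nonneg.2 h0) hτ])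
  simp only [Pi.sub_apply] at h
  rw [integral_sub (integrable_sq_stdGaussian.const_mul _) (integrable_const _),
    integral_const_mul, integral_sq_stdGaussian] at h
  simp at h
  unfold softRisk
  simp only [zero_add, sub_zero]
  linarith

lemma exists_softRisk_zero_le : ∃ a, 0 < a ∧ ∀ τ, 0 ≤ τ →
    softRisk 0 τ ≤ 1 - a * τ + τ ^ 2 := by
  have hp := measureReal_stdGaussian_Ioo_pos (show (1 : ℝ) < 2 by norm_num)
  refine ⟨_, hp, fun τ hτ => ?_⟩
  have hJ : Integrable ((Ioo (1 : ℝ) 2).indicator fun _ => τ) stdGaussian :=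
    (integrable_const _).indicator measurableSet_Ioo
  have hI := integrable_sq_stdGaussian.sub hJ
  have h := integral_mono (integrable_sq_soft_sub le_rfl hτ) (hI.add (integrable_const (τ ^ 2)))
    (fun z => by
      simp only [Pi.add_apply, Pi.sub_apply, zero_add, sub_zero]
      have hi : (Ioo (1 : ℝ) 2).indicator (fun _ => τ) z ≤ τ * |z| := by
        by_cases hz : z ∈ Ioo (1 : ℝ) 2
        swap
        · rw [indicator_of_notMem hz]; positivity
        rw [indicator_of_mem hz]
        have : 1 ≤ |z| := hz.1.le.trans (le_abs_self z)
        nlinarith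
      have hz := sq_abs z
      rcases lt_or_ge τ z with h | h
      · rw [soft_of_lt hτ h]
        rw [abs_of_pos (by linarith)] at hi; nlinarith
      rcases lt_or_ge z (-τ) with h' | h'
      · rw [soft_of_lt_neg hτ h']
        rw [abs_of_neg (by linarith)] at hi; nlinarith
      · rw [soft_of_abs_le (abs_le.2 ⟨h', h⟩)]
        nlinarith [sq_nonneg (|z| - τ), abs_nonneg z])
  rw [integral_add' hI (integrable_const _), integral_sub' integrable_sq_stdGaussian hJ,
    integral_indicator_const _ measurableSet_Ioo, integral_sq_stdGaussian] at h
  simp at h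
  unfold softRisk
  simp only [zero_add, sub_zero]
  linarith

lemma stronglyMeasurable_softRisk {τ : ℝ} (hτ : 0 ≤ τ) :
    StronglyMeasurable (fun μ => softRisk μ τ) :=
  (continuous_soft_add_sub hτ).stronglyMeasurable.integral_prod_right

lemma integrable_softRisk_div (ν : Measure ℝ) [IsFiniteMeasure ν] (σ : ℝ) {τ : ℝ} (hτ : 0 ≤ τ) :
    Integrable (fun b => softRisk (b / σ) τ) ν := by
  refine Integrable.of_bound ((stronglyMeasurable_softRisk hτ).comp_measurable
    (measurable_id.div_const σ)).aestronglyMeasurable (1 + τ ^ 2) (ae_of_all _ fun b => ?_)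
  rw [Real.norm_of_nonneg (softRisk_nonneg _ _)]
  exact softRisk_le _ hτ

lemma integral_mix_soft {ε : ℝ} (hε : ε ∈ Ioo (0 : ℝ) 1) (g : Measure ℝ) [IsProbabilityMeasure g]
    {σ τ : ℝ} (hσ : 0 < σ) (hτ : 0 ≤ τ) :
    ∫ b, (∫ z, (soft (b + σ * z) (σ * τ) - b) ^ 2 ∂stdGaussian) ∂(mix ε g) =
      σ ^ 2 * ((1 - ε) * softRisk 0 τ + ε * ∫ b, softRisk (b / σ) τ ∂g) := by
  have h : ∀ b : ℝ, ∫ z, (soft (b + σ * z) (σ * τ) - b) ^ 2 ∂stdGaussian =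
      σ ^ 2 * softRisk (b / σ) τ := by
    intro b
    rw [softRisk, ← integral_const_mul]
    congr 1; ext z
    have hb : b = σ * (b / σ) := by field_simp
    have hz : b + σ * z = σ * (b / σ + z) := by field_simp
    rw [hz, soft_mul_left hσ _ hτ]
    nth_rewrite 2 [hb]
    ring
  simp_rw [h]
  rw [integral_const_mul, mix, integral_add_measure
      ((integrable_softRisk_div _ σ hτ).smul_measure ENNReal.ofReal_ne_top)
      ((integrable_softRisk_div _ σ hτ).smul_measure ENNReal.ofReal_ne_top),
    integral_smul_measure, integral_smul_measure, integral_dirac,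
    ENNReal.toReal_ofReal (by linarith [hε.2]), ENNReal.toReal_ofReal hε.1.le]
  simp

lemma summable_exp_neg_mul_rpow (ell : ℝ) :
    Summable (fun k : ℕ => exp (-k) * ((k : ℝ) + 1) ^ ell) := by
  have h := ((summable_nat_add_iff 1).2
    (Real.summable_pow_mul_exp_neg_nat_mul ⌈ell⌉₊ one_pos)).mul_left (exp 1)
  refine Summable.of_nonneg_of_le (fun k => by positivity) (fun k => ?_) h
  have h1 : ((k : ℝ) + 1) ^ ell ≤ ((k : ℝ) + 1) ^ ⌈ell⌉₊ := by
    rw [← Real.rpow_natCast]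
    exact Real.rpow_le_rpow_of_exponent_le (by linarith [Nat.cast_nonneg (α := ℝ) k])
      (Nat.le_ceil ell)
  have h2 : exp (-(k : ℝ)) = exp 1 * exp (-1 * ((k + 1 : ℕ) : ℝ)) := by
    rw [← exp_add]; push_cast; ring_nf
  rw [h2]
  push_cast
  have : 0 < exp 1 * exp (-1 * ((k : ℝ) + 1)) := by positivity
  nlinarith

lemma exists_integral_exp_neg_abs_div_le {ell c : ℝ} (hc : 0 < c)
    (g : Measure ℝ) [IsProbabilityMeasure g]
    (hg : ∀ t, 0 < t → g.real {x : ℝ | |x| ≤ t} ≤ c * t ^ ell) :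
    ∃ C, 0 < C ∧ ∀ σ, 0 < σ → ∫ b, exp (-|b / σ|) ∂g ≤ C * σ ^ ell := by
  have hs := summable_exp_neg_mul_rpow ell
  refine ⟨c * ∑' k : ℕ, exp (-k) * ((k : ℝ) + 1) ^ ell,
    mul_pos hc (hs.tsum_pos (fun k => by positivity) 0 (by positivity)), fun σ hσ => ?_⟩
  have hσe : 0 < σ ^ ell := Real.rpow_pos_of_pos hσ ell
  have hms : ∀ t : ℝ, MeasurableSet {x : ℝ | |x| ≤ t} := fun t =>
    measurableSet_le (by fun_prop) measurable_const
  rw [integral_eq_lintegral_of_nonneg_ae (ae_of_all _ fun b => (exp_pos _).le)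
    (by fun_prop : Measurable fun b : ℝ => exp (-|b / σ|)).aestronglyMeasurable]
  refine ENNReal.toReal_le_of_le_ofReal (by positivity) ?_
  calc ∫⁻ b, ENNReal.ofReal (exp (-|b / σ|)) ∂g
      ≤ ∫⁻ b, ∑' k : ℕ, {x : ℝ | |x| ≤ σ * (k + 1)}.indicator
          (fun _ => ENNReal.ofReal (exp (-k))) b ∂g := by
        refine lintegral_mono fun b => ?_
        refine le_trans ?_ (ENNReal.le_tsum ⌊|b / σ|⌋₊)
        have h0 : 0 ≤ |b / σ| := abs_nonneg _
        have hb : b ∈ {x : ℝ | |x| ≤ σ * ((⌊|b / σ|⌋₊ : ℝ) + 1)} := by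
          have h1 := (Nat.lt_floor_add_one |b / σ|).le
          have h2 : |b| = σ * |b / σ| := by
            rw [abs_div, abs_of_pos hσ]; field_simp
          change |b| ≤ _
          rw [h2]
          gcongr
        rw [indicator_of_mem hb]
        refine ENNReal.ofReal_le_ofReal (exp_le_exp.2 ?_)
        linarith [Nat.floor_le h0]
    _ = ∑' k : ℕ, ENNReal.ofReal (exp (-k)) * g {x : ℝ | |x| ≤ σ * (k + 1)} := by
        rw [lintegral_tsum fun k => (measurable_const.indicator (hms _)).aemeasurable]
        simp_rw [lintegral_indicator_const (hms _)]
    _ ≤ ∑' k : ℕ, ENNReal.ofReal (c * σ ^ ell * (exp (-k) * ((k : ℝ) + 1) ^ ell)) := by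
        refine ENNReal.tsum_le_tsum fun k => ?_
        have h := hg (σ * (k + 1)) (by positivity)
        rw [← ofReal_measureReal, ← ENNReal.ofReal_mul (exp_pos _).le]
        refine ENNReal.ofReal_le_ofReal ?_
        rw [Real.mul_rpow hσ.le (by positivity)] at h
        calc _ ≤ exp (-(k : ℝ)) * (c * (σ ^ ell * ((k : ℝ) + 1) ^ ell)) := by gcongr
          _ = _ := by ring
    _ = ENNReal.ofReal (c * (∑' k : ℕ, exp (-k) * ((k : ℝ) + 1) ^ ell) * σ ^ ell) := by
        rw [← ENNReal.ofReal_tsum_of_nonneg (fun k => by positivity) (hs.mul_left _),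
          tsum_mul_left]
        ring_nf

lemma M1_eq_iInf (ε : ℝ) :
    M1 ε = ⨅ τ : NNReal, ((1 - ε) * softRisk 0 (τ : ℝ) + ε * (1 + (τ : ℝ) ^ 2)) := by
  simp [M1, softRisk]

lemma le_M1_objective {ε : ℝ} (hε : ε ∈ Ioo (0 : ℝ) 1) (τ : ℝ) :
    ε * (1 + τ ^ 2) ≤ (1 - ε) * softRisk 0 τ + ε * (1 + τ ^ 2) := by
  nlinarith [mul_nonneg (sub_nonneg.2 hε.2.le) (softRisk_nonneg 0 τ)]

lemma M1_le {ε : ℝ} (hε : ε ∈ Ioo (0 : ℝ) 1) {τ : ℝ} (hτ : 0 ≤ τ) :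
    M1 ε ≤ (1 - ε) * softRisk 0 τ + ε * (1 + τ ^ 2) := by
  rw [M1_eq_iInf]
  refine ciInf_le ⟨0, ?_⟩ (⟨τ, hτ⟩ : NNReal)
  rintro _ ⟨t, rfl⟩
  exact le_trans (mul_nonneg hε.1.le (by positivity)) (le_M1_objective hε _)

lemma M1_pos {ε : ℝ} (hε : ε ∈ Ioo (0 : ℝ) 1) : 0 < M1 ε := by
  rw [M1_eq_iInf]
  refine hε.1.trans_le (le_ciInf fun t => le_trans ?_ (le_M1_objective hε _))
  nlinarith [mul_nonneg hε.1.le (sq_nonneg (t : ℝ))]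

lemma M1_lt_one {ε : ℝ} (hε : ε ∈ Ioo (0 : ℝ) 1) : M1 ε < 1 := by
  obtain ⟨a, ha, h⟩ := exists_softRisk_zero_le
  have hb : 0 < (1 - ε) * a := mul_pos (sub_pos.2 hε.2) ha
  have hτ : 0 ≤ (1 - ε) * a / 2 := by positivity
  refine (M1_le hε hτ).trans_lt ?_
  have := mul_le_mul_of_nonneg_left (h _ hτ) (sub_nonneg.2 hε.2.le)
  nlinarith

lemma exists_M1_objective_lt {ε η : ℝ} (hη : 0 < η) : ∃ τ, 0 ≤ τ ∧
    (1 - ε) * softRisk 0 τ + ε * (1 + τ ^ 2) < M1 ε + η := by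
  have h : M1 ε < M1 ε + η := by linarith
  nth_rewrite 1 [M1_eq_iInf] at h
  obtain ⟨t, ht⟩ := exists_lt_of_ciInf_lt h
  exact ⟨t, t.2, ht⟩

lemma riskMin_soft_nonneg (ν : Measure ℝ) (σ : ℝ) : 0 ≤ riskMin soft ν σ :=
  le_ciInf fun _ => integral_nonneg fun _ => integral_nonneg fun _ => sq_nonneg _

lemma riskMin_soft_le {ε : ℝ} (hε : ε ∈ Ioo (0 : ℝ) 1) (g : Measure ℝ) [IsProbabilityMeasure g]
    {σ τ : ℝ} (hσ : 0 < σ) (hτ : 0 ≤ τ) :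
    riskMin soft (mix ε g) σ ≤
      σ ^ 2 * ((1 - ε) * softRisk 0 τ + ε * ∫ b, softRisk (b / σ) τ ∂g) := by
  rw [← integral_mix_soft hε g hσ hτ]
  refine ciInf_le ⟨0, ?_⟩ (⟨σ * τ, by positivity⟩ : NNReal)
  rintro _ ⟨t, rfl⟩
  exact integral_nonneg fun _ => integral_nonneg fun _ => sq_nonneg _

lemma le_riskMin_soft {ε : ℝ} (hε : ε ∈ Ioo (0 : ℝ) 1) (g : Measure ℝ) [IsProbabilityMeasure g]
    {σ r : ℝ} (hσ : 0 < σ)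
    (h : ∀ τ, 0 ≤ τ → r ≤ (1 - ε) * softRisk 0 τ + ε * ∫ b, softRisk (b / σ) τ ∂g) :
    σ ^ 2 * r ≤ riskMin soft (mix ε g) σ := by
  refine le_ciInf fun t => ?_
  have ht : (t : ℝ) = σ * (t / σ) := by field_simp
  have ht0 : (0 : ℝ) ≤ t / σ := div_nonneg t.2 hσ.le
  rw [ht, integral_mix_soft hε g hσ ht0]
  exact mul_le_mul_of_nonneg_left (h _ ht0) (sq_nonneg _)

lemma riskMin_soft_le_sq_mul_M1 {ε : ℝ} (hε : ε ∈ Ioo (0 : ℝ) 1) (g : Measure ℝ)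
    [IsProbabilityMeasure g] {σ : ℝ} (hσ : 0 < σ) :
    riskMin soft (mix ε g) σ ≤ σ ^ 2 * M1 ε := by
  rw [M1_eq_iInf, Real.mul_iInf_of_nonneg (sq_nonneg σ)]
  refine le_ciInf fun t => (riskMin_soft_le hε g hσ t.2).trans ?_
  have h : ∫ b, softRisk (b / σ) t ∂g ≤ 1 + (t : ℝ) ^ 2 := by
    have := integral_mono (integrable_softRisk_div g σ t.2)
      (integrable_const (1 + (t : ℝ) ^ 2)) fun b => softRisk_le (b / σ) t.2
    simpa using this
  exact mul_le_mul_of_nonneg_left (add_le_add le_rfl (mul_le_mul_of_nonneg_left h hε.1.le))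
    (sq_nonneg σ)

lemma measurableSet_abs_le (t : ℝ) : MeasurableSet {x : ℝ | |x| ≤ t} :=
  measurableSet_le (by fun_prop) measurable_const

lemma exists_riskMin_soft_le_sub {ε ell c₁ t₀ : ℝ} (hε : ε ∈ Ioo (0 : ℝ) 1) (hc₁ : 0 < c₁)
    (g : Measure ℝ) [IsProbabilityMeasure g]
    (hg : ∀ t ∈ Ioc (0 : ℝ) t₀, c₁ * t ^ ell ≤ g.real {x : ℝ | |x| ≤ t}) :
    ∃ c, 0 < c ∧ ∀ σ ∈ Ioc (0 : ℝ) t₀,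
      riskMin soft (mix ε g) σ ≤ σ ^ 2 * (M1 ε - c * σ ^ ell) := by
  have hM := M1_lt_one hε
  set η₀ := (1 - M1 ε) / 2 with hη₀
  set T := 1 / ε with hT
  have hε0 := hε.1
  obtain ⟨c, hc, hgap⟩ := exists_softRisk_le_sub (show 0 < η₀ / 2 by linarith) T
  refine ⟨ε * (c * c₁), by positivity, fun σ hσ => ?_⟩
  have hσ0 : 0 < σ := hσ.1
  have key : ∀ η, 0 < η → η < η₀ →
      riskMin soft (mix ε g) σ ≤ σ ^ 2 * (M1 ε - ε * (c * c₁) * σ ^ ell + η) := by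
    intro η hη hηη
    obtain ⟨τ, hτ, hlt⟩ := exists_M1_objective_lt (ε := ε) hη
    have hτl : η₀ / 2 ≤ τ := by
      have := mul_le_mul_of_nonneg_left (softRisk_zero_ge hτ) (sub_nonneg.2 hε.2.le)
      nlinarith [mul_nonneg hε.1.le (sq_nonneg τ), mul_nonneg hε.1.le hτ]
    have hτT : τ ≤ T := by
      have h1 := le_M1_objective hε τ
      rw [hT, le_div_iff₀ hε0]
      nlinarith [mul_nonneg hε0.le (sq_nonneg (τ - 1))]
    refine (riskMin_soft_le hε g hσ0 hτ).trans ?_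
    have hI : Integrable ({x : ℝ | |x| ≤ σ}.indicator fun _ => c) g :=
      (integrable_const _).indicator (measurableSet_abs_le σ)
    have h := integral_mono (integrable_softRisk_div g σ hτ)
      ((integrable_const (1 + τ ^ 2)).sub hI) fun b => by
        simp only [Pi.sub_apply]
        by_cases hb : b ∈ {x : ℝ | |x| ≤ σ}
        · rw [indicator_of_mem hb]
          refine hgap _ _ ?_ hτl hτT
          rw [abs_div, abs_of_pos hσ0, div_le_one hσ0]
          exact hb
        · rw [indicator_of_notMem hb, sub_zero]
          exact softRisk_le _ hτ
    rw [integral_sub' (integrable_const _) hI,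
      integral_indicator_const _ (measurableSet_abs_le σ)] at h
    simp only [integral_const, probReal_univ, smul_eq_mul, one_mul] at h
    have h3 := mul_le_mul_of_nonneg_left (hg σ hσ) hc.le
    have h4 := mul_le_mul_of_nonneg_left (h.trans (show _ ≤ 1 + τ ^ 2 - c * (c₁ * σ ^ ell) by
      linarith)) hε0.le
    exact mul_le_mul_of_nonneg_left (by linarith) (sq_nonneg σ)
  have hlim : Tendsto (fun η : ℝ => σ ^ 2 * (M1 ε - ε * (c * c₁) * σ ^ ell + η))
      (nhdsWithin 0 (Ioi 0)) (nhds (σ ^ 2 * (M1 ε - ε * (c * c₁) * σ ^ ell + 0))) :=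
    (Continuous.tendsto (by fun_prop) 0).mono_left nhdsWithin_le_nhds
  rw [add_zero] at hlim
  refine ge_of_tendsto hlim ?_
  filter_upwards [Ioo_mem_nhdsGT (show 0 < η₀ by linarith)] with η h
  exact key η h.1 h.2

lemma exists_sub_le_riskMin_soft {ε ell c t₁ : ℝ} (hε : ε ∈ Ioo (0 : ℝ) 1) (hc : 0 < c)
    (g : Measure ℝ) [IsProbabilityMeasure g]
    (hg : ∀ t, 0 < t → g.real {x : ℝ | |x| ≤ t} ≤ c * t ^ ell)
    (ht₁ : 0 < t₁) (hg₁ : g.real {x : ℝ | |x| ≤ t₁} ≤ 1 / 2) :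
    ∃ C σ₁, 0 < C ∧ 0 < σ₁ ∧ ∀ σ ∈ Ioo (0 : ℝ) σ₁,
      σ ^ 2 * (M1 ε - C * σ ^ ell) ≤ riskMin soft (mix ε g) σ := by
  have hε0 := hε.1
  obtain ⟨p, hp, hpr⟩ := exists_softRisk_ge_min_sq
  set T := 2 / (ε * p) + 1 with hT
  have hT1 : 1 ≤ T := by rw [hT]; linarith [show 0 < 2 / (ε * p) by positivity]
  have hTp : 2 ≤ ε * p * T := by
    have : ε * p * (2 / (ε * p)) = 2 := by field_simp
    rw [hT]; nlinarith [mul_pos hε0 hp]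
  obtain ⟨A, hA, hAr⟩ := exists_softRisk_ge_sub_exp T
  obtain ⟨K, hK, hKr⟩ := exists_integral_exp_neg_abs_div_le hc g hg
  refine ⟨ε * (A * K), t₁ / T, by positivity, by positivity, fun σ hσ => ?_⟩
  have hσ0 : 0 < σ := hσ.1
  refine le_riskMin_soft hε g hσ0 fun τ hτ => ?_
  have hσe : 0 < σ ^ ell := Real.rpow_pos_of_pos hσ0 ell
  rcases le_total τ T with hτT | hτT
  · have hI : Integrable (fun b => A * exp (-|b / σ|)) g :=
      (Integrable.of_bound (by fun_prop : Measurable fun b : ℝ =>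
        exp (-|b / σ|)).aestronglyMeasurable 1 (ae_of_all _ fun b => by
        rw [Real.norm_of_nonneg (exp_pos _).le]
        exact exp_le_one_iff.2 (by simp))).const_mul A
    have h := integral_mono ((integrable_const (1 + τ ^ 2)).sub hI)
      (integrable_softRisk_div g σ hτ) fun b => hAr (b / σ) τ hτ hτT
    rw [integral_sub' (integrable_const _) hI, integral_const_mul] at h
    simp only [integral_const, probReal_univ, smul_eq_mul, one_mul] at h
    have h1 := mul_le_mul_of_nonneg_left (hKr σ hσ0) hA.le
    have h2 := mul_le_mul_of_nonneg_left ((show 1 + τ ^ 2 - A * (K * σ ^ ell) ≤ _ by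
      linarith).trans h) hε0.le
    linarith [M1_le hε hτ]
  · have hS := measurableSet_abs_le t₁
    have hI : Integrable ({x : ℝ | |x| ≤ t₁}ᶜ.indicator fun _ => p * T) g :=
      (integrable_const _).indicator hS.compl
    have h := integral_mono hI (integrable_softRisk_div g σ hτ) fun b => by
      by_cases hb : b ∈ {x : ℝ | |x| ≤ t₁}
      · rw [indicator_of_notMem (by simpa using hb)]
        exact softRisk_nonneg _ _
      · rw [indicator_of_mem hb]
        refine le_trans ?_ (hpr _ _ hτ)
        have hm : T ≤ min |b / σ| τ := by
          refine le_min ?_ hτT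
          rw [abs_div, abs_of_pos hσ0, le_div_iff₀ hσ0]
          have h1 := (lt_div_iff₀ (by linarith)).1 hσ.2
          have h2 : t₁ < |b| := not_le.1 hb
          linarith
        have : T ≤ (min |b / σ| τ) ^ 2 := by nlinarith
        exact mul_le_mul_of_nonneg_left this hp.le
    rw [integral_indicator_const _ hS.compl, probReal_compl_eq_one_sub hS, smul_eq_mul] at h
    have h1 : p * T / 2 ≤ ∫ b, softRisk (b / σ) τ ∂g := by
      have : 0 < p * T := by positivity
      nlinarith
    have h2 := mul_le_mul_of_nonneg_left h1 hε0.le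
    have h3 : 0 < ε * (A * K) * σ ^ ell := by positivity
    linarith [M1_lt_one hε, mul_nonneg (sub_nonneg.2 hε.2.le) (softRisk_nonneg 0 τ)]

lemma tendsto_iterLog_atTop (m : ℕ) : Tendsto (iterLog m) atTop atTop := by
  induction m with
  | zero => exact tendsto_id
  | succ n ih => exact Real.tendsto_log_atTop.comp ih

/-- For `q = 1` (LASSO), if `c₁ t^ℓ ≤ P(|G| ≤ t) ≤ c₂ t^ℓ` for small `t`, `E[G²] < ∞` and
`δ > M₁(ε)`, then for every `m ≥ 1` there are `α_m, β_m > 0` with, for all small `σ_w > 0`,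
`−β_m σ_w^{ℓ+2}(log∘⋯∘log(1/σ_w))^{ℓ/2} ≤ AMSE(σ_w) − δM₁(ε)/(δ−M₁(ε))·σ_w² ≤ −α_m σ_w^{ℓ+2}`.
Here `σb σ_w` is the unique positive solution `σ̄` of
`σ̄² = σ_w² + (1/δ)·min_{χ≥0}E[(η₁(B+σ̄Z;χ)−B)²]` and `AMSE(σ_w) = riskMin soft (mix ε g) (σb σ_w)`. -/
theorem lasso_amse_expansion_polynomial
    (δ ε ell c₁ c₂ t₀ : ℝ) (hδ0 : 0 < δ) (hδ : M1 ε < δ) (hε : ε ∈ Ioo (0:ℝ) 1)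
    (hell : 0 < ell) (hc₁ : 0 < c₁) (hc₂ : 0 < c₂) (ht₀ : 0 < t₀)
    (g : Measure ℝ) [IsProbabilityMeasure g] (hg0 : g {0} = 0)
    (hG2 : Integrable (fun x => x^2) g)
    (hG : ∀ t ∈ Ioc (0:ℝ) t₀,
      c₁ * t ^ ell ≤ (g {x : ℝ | |x| ≤ t}).toReal ∧
      (g {x : ℝ | |x| ≤ t}).toReal ≤ c₂ * t ^ ell)
    (σb : ℝ → ℝ)
    (hσb : ∀ s, 0 < s → 0 < σb s ∧
      (σb s) ^ 2 = s ^ 2 + (1/δ) * riskMin soft (mix ε g) (σb s)) :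
    ∀ m : ℕ, 1 ≤ m → ∃ α β : ℝ, 0 < α ∧ 0 < β ∧
      ∀ᶠ s in nhdsWithin (0:ℝ) (Ioi 0),
        -β * s ^ (ell + 2) * (iterLog m (1/s)) ^ (ell/2)
            ≤ riskMin soft (mix ε g) (σb s) - (δ * M1 ε / (δ - M1 ε)) * s ^ 2 ∧
        riskMin soft (mix ε g) (σb s) - (δ * M1 ε / (δ - M1 ε)) * s ^ 2
            ≤ -α * s ^ (ell + 2) := by
  intro m _
  have hε0 := hε.1
  have hM := M1_pos hε
  obtain ⟨c, hc, hup⟩ := exists_riskMin_soft_le_sub hε hc₁ g fun t ht => (hG t ht).1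
  have hg : ∀ t, 0 < t → g.real {x : ℝ | |x| ≤ t} ≤ (c₂ + t₀ ^ (-ell)) * t ^ ell := by
    intro t ht
    have hte := Real.rpow_pos_of_pos ht ell
    have ht₀e := Real.rpow_pos_of_pos ht₀ (-ell)
    rcases le_or_gt t t₀ with h | h
    · exact ((hG t ⟨ht, h⟩).2).trans (by nlinarith [mul_pos ht₀e hte])
    · refine (measureReal_le_one (μ := g)).trans ?_
      have h1 : t₀ ^ ell ≤ t ^ ell := Real.rpow_le_rpow ht₀.le h.le hell.le
      have h2 : t₀ ^ (-ell) * t₀ ^ ell = 1 := by rw [← Real.rpow_add ht₀]; simp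
      nlinarith [mul_pos hc₂ hte]
  obtain ⟨t₁, ht₁, hg₁⟩ : ∃ t₁, 0 < t₁ ∧ g.real {x : ℝ | |x| ≤ t₁} ≤ 1 / 2 := by
    have hlim : Tendsto (fun t : ℝ => (c₂ + t₀ ^ (-ell)) * t ^ ell) (nhdsWithin 0 (Ioi 0))
        (nhds ((c₂ + t₀ ^ (-ell)) * 0 ^ ell)) :=
      (((Real.continuous_rpow_const hell.le).tendsto 0).const_mul _).mono_left nhdsWithin_le_nhds
    rw [Real.zero_rpow hell.ne', mul_zero] at hlim
    obtain ⟨t, h1, h2⟩ := ((hlim.eventually_lt_const (show (0 : ℝ) < 1 / 2 by norm_num)).and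
      self_mem_nhdsWithin).exists
    exact ⟨t, h2, (hg t h2).trans h1.le⟩
  obtain ⟨C, σ₁, hC, hσ₁, hlo⟩ := exists_sub_le_riskMin_soft hε
    (add_pos hc₂ (Real.rpow_pos_of_pos ht₀ (-ell))) g hg ht₁ hg₁
  have hd : 0 < δ - M1 ε := sub_pos.2 hδ
  set κ := δ / (δ - M1 ε) with hκ
  have hκ0 : 0 < κ := div_pos hδ0 hd
  have hsq : 0 < √κ := Real.sqrt_pos.2 hκ0
  refine ⟨κ * c, κ * (C * √κ ^ (ell + 2)), by positivity, by positivity, ?_⟩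
  have hlog : ∀ᶠ s in nhdsWithin (0 : ℝ) (Ioi 0), 1 ≤ iterLog m (1 / s) := by
    have := (tendsto_iterLog_atTop m).comp tendsto_inv_nhdsGT_zero
    filter_upwards [this.eventually_ge_atTop 1] with s hs
    simpa using hs
  have hr : 0 < min t₀ σ₁ / √κ := div_pos (lt_min ht₀ hσ₁) hsq
  filter_upwards [hlog, Ioo_mem_nhdsGT hr] with s hs ⟨hs0, hsr⟩
  obtain ⟨hσ0, hσeq⟩ := hσb s hs0
  set σ := σb s
  set R := riskMin soft (mix ε g) σ
  have hR0 : 0 ≤ R := riskMin_soft_nonneg _ _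
  have hRM : R ≤ σ ^ 2 * M1 ε := riskMin_soft_le_sq_mul_M1 hε g hσ0
  have hδR : δ * σ ^ 2 = δ * s ^ 2 + R := by rw [hσeq]; field_simp
  have hsσ : s ≤ σ := by
    refine le_of_sq_le_sq ?_ hσ0.le
    nlinarith
  have hσs : σ ≤ √κ * s := by
    refine le_of_sq_le_sq ?_ (by positivity)
    rw [mul_pow, Real.sq_sqrt hκ0.le, hκ, div_mul_eq_mul_div, le_div_iff₀ hd]
    linarith
  have hσlt : σ < min t₀ σ₁ := hσs.trans_lt (by rw [lt_div_iff₀ hsq] at hsr; linarith)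
  have hdiff : R - δ * M1 ε / (δ - M1 ε) * s ^ 2 = κ * (R - σ ^ 2 * M1 ε) := by
    rw [hκ]
    field_simp
    linear_combination (M1 ε) * hδR
  have hpow : ∀ x : ℝ, 0 < x → x ^ (ell + 2) = x ^ 2 * x ^ ell := fun x hx => by
    rw [Real.rpow_add hx, Real.rpow_two, mul_comm]
  have h1 := hup σ ⟨hσ0, (hσlt.trans_le (min_le_left _ _)).le⟩
  have h2 := hlo σ ⟨hσ0, hσlt.trans_le (min_le_right _ _)⟩
  have h3 : s ^ (ell + 2) ≤ σ ^ (ell + 2) := Real.rpow_le_rpow hs0.le hsσ (by linarith)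
  have h4 : σ ^ (ell + 2) ≤ √κ ^ (ell + 2) * s ^ (ell + 2) := by
    rw [← Real.mul_rpow hsq.le hs0.le]
    exact Real.rpow_le_rpow hσ0.le hσs (by linarith)
  have h5 : 1 ≤ iterLog m (1 / s) ^ (ell / 2) := Real.one_le_rpow hs (by positivity)
  have hse : 0 < s ^ (ell + 2) := Real.rpow_pos_of_pos hs0 _
  rw [hdiff]
  constructor
  · have h6 : -(C * σ ^ (ell + 2)) ≤ R - σ ^ 2 * M1 ε := by rw [hpow σ hσ0]; linarith
    have h7 : C * σ ^ (ell + 2) ≤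
        C * (√κ ^ (ell + 2) * s ^ (ell + 2) * iterLog m (1 / s) ^ (ell / 2)) :=
      mul_le_mul_of_nonneg_left (h4.trans (le_mul_of_one_le_right (by positivity) h5)) hC.le
    calc _ = κ * -(C * (√κ ^ (ell + 2) * s ^ (ell + 2) * iterLog m (1 / s) ^ (ell / 2))) := by ring
      _ ≤ _ := by gcongr; linarith
  · have h6 : R - σ ^ 2 * M1 ε ≤ -(c * σ ^ (ell + 2)) := by rw [hpow σ hσ0]; linarith
    have h7 := mul_le_mul_of_nonneg_left h3 hc.le
    calc _ ≤ κ * -(c * s ^ (ell + 2)) := by gcongr; linarith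
      _ = _ := by ring
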